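/- Let ℓ ≤ N−1 and let λ = (λ_1 ≥ λ_2 ≥ … ≥ λ_ℓ ≥ 0) be a partition with at most ℓ parts. Then B⁺_ℓ m_λ = a_λ m_{λ+1} + Σ_{λ' < λ+1} d_{λ,λ'} m_{λ'}, where a_λ = (λ_ℓ + β)(λ_{ℓ−1} + 2β) ⋯ (λ_1 + ℓβ) = Π_{j=1}^{ℓ} (λ_{ℓ+1−j} + jβ), λ+1 = (λ_1+1, …, λ_ℓ+1), the sum is over partitions λ' of |λ|+ℓ strictly smaller than λ+1 in dominance order, and d_{λ,λ'} ∈ F are some coefficients. -/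

import Mathlib

open MvPolynomial Finset

section CSDefs

variable {F : Type*} [Field F] [CharZero F]

/-- Exact division in a polynomial ring: `divExact d f = f / d` when `d ∣ f`, junk otherwise. -/
noncomputable def divExact {σ : Type*} (d f : MvPolynomial σ F) : MvPolynomial σ F := by
  classical exact if h : ∃ c, f = d * c then h.choose else 0

/-- The exchange operator `K_{ij}` permuting the variables `z_i` and `z_j`. -/
noncomputable def Kswap {N : ℕ} (i j : Fin N) (f : MvPolynomial (Fin N) F) :
    MvPolynomial (Fin N) F :=
  rename (Equiv.swap i j) f

/-- The Dunkl operator `∇_i = ∂_i + β ∑_{j ≠ i} (z_i - z_j)⁻¹ (1 - K_{ij})`. -/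
noncomputable def nabla {N : ℕ} (β : F) (i : Fin N) (f : MvPolynomial (Fin N) F) :
    MvPolynomial (Fin N) F :=
  pderiv i f + β • ∑ j ∈ Finset.univ.erase i, divExact (X i - X j) (f - Kswap i j f)

/-- `D_i = z_i ∇_i`. -/
noncomputable def Dop {N : ℕ} (β : F) (i : Fin N) (f : MvPolynomial (Fin N) F) :
    MvPolynomial (Fin N) F :=
  X i * nabla β i f

/-- `(D_{j₁} + kβ)(D_{j₂} + (k+1)β) ⋯` applied along a list of indices. -/
noncomputable def Dlist {N : ℕ} (β : F) :
    ℕ → List (Fin N) → MvPolynomial (Fin N) F → MvPolynomial (Fin N) F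
  | _, [], f => f
  | k, j :: rest, f => Dop β j (Dlist β (k + 1) rest f) + ((k : F) * β) • Dlist β (k + 1) rest f

/-- `D_{k,J} = (D_{j₁} + kβ)(D_{j₂} + (k+1)β) ⋯ (D_{j_ℓ} + (k+ℓ-1)β)` for
`J = {j₁ < j₂ < … < j_ℓ}`. -/
noncomputable def DJ {N : ℕ} (β : F) (k : ℕ) (J : Finset (Fin N))
    (f : MvPolynomial (Fin N) F) : MvPolynomial (Fin N) F :=
  Dlist β k (J.sort (· ≤ ·)) f

/-- `z_J = ∏_{i ∈ J} z_i`. -/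
noncomputable def zJ {N : ℕ} (J : Finset (Fin N)) : MvPolynomial (Fin N) F := ∏ i ∈ J, X i

/-- The creation operator `B⁺_{i,J} = ∑_{J' ⊆ J, |J'| = i} z_{J'} D_{1,J'}`. -/
noncomputable def Bplus {N : ℕ} (β : F) (i : ℕ) (J : Finset (Fin N))
    (f : MvPolynomial (Fin N) F) : MvPolynomial (Fin N) F :=
  ∑ J' ∈ J.powersetCard i, zJ J' * DJ β 1 J' f

/-- `A_{ij} = ((z_i+z_j)/(z_i-z_j))(z_i ∂_i - z_j ∂_j)`. -/
noncomputable def Aop {N : ℕ} (i j : Fin N) (f : MvPolynomial (Fin N) F) :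
    MvPolynomial (Fin N) F :=
  divExact (X i - X j) ((X i + X j) * (X i * pderiv i f - X j * pderiv j f))

/-- `H^{(S)} = ∑_{i ∈ S} (z_i ∂_i)² + β ∑_{i<j, i,j ∈ S} A_{ij}`. -/
noncomputable def Hop {N : ℕ} (β : F) (S : Finset (Fin N)) (f : MvPolynomial (Fin N) F) :
    MvPolynomial (Fin N) F :=
  ∑ i ∈ S, X i * pderiv i (X i * pderiv i f)
    + β • ∑ i ∈ S, ∑ j ∈ S.filter (fun j => i < j), Aop i j f

/-- A polynomial is symmetric in the variables indexed by `S`. -/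
def SymmOn {N : ℕ} (S : Finset (Fin N)) (f : MvPolynomial (Fin N) F) : Prop :=
  ∀ i ∈ S, ∀ j ∈ S, rename (Equiv.swap i j) f = f

/-- `phiCS β N lam i = (B⁺_i)^{λ_i - λ_{i+1}} ⋯ (B⁺_1)^{λ_1 - λ_2} · 1`,
where `lam` is 0-indexed: `lam (j-1) = λ_j`. -/
noncomputable def phiCS (β : F) (N : ℕ) (lam : ℕ → ℕ) : ℕ → MvPolynomial (Fin N) F
  | 0 => 1
  | i + 1 => (fun f => Bplus β (i + 1) Finset.univ f)^[lam i - lam (i + 1)] (phiCS β N lam i)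

/-- The monomial symmetric polynomial attached to an exponent vector. -/
noncomputable def msym (N : ℕ) (lam : Fin N → ℕ) : MvPolynomial (Fin N) F := by
  classical
  exact ∑ v ∈ (Finset.univ : Finset (Equiv.Perm (Fin N))).image
      (fun σ => fun i => lam (σ i)), ∏ i, X i ^ v i

/-- `𝐷̂_i = D_i + β(i-1) - β ∑_{j<i} (1 - K_{ij})` (0-indexed: `i-1` becomes `i`). -/
noncomputable def Dhat {N : ℕ} (β : F) (i : Fin N) (f : MvPolynomial (Fin N) F) :
    MvPolynomial (Fin N) F :=
  Dop β i f + (β * ((i : ℕ) : F)) • f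
    - β • ∑ j ∈ Finset.univ.filter (fun j => j < i), (f - Kswap i j f)

end CSDefs

section Dunkl

variable {F : Type*} [Field F] {N : ℕ}

/-- The divided difference `(z_i - z_j)⁻¹ (1 - K_{ij})`. -/
noncomputable def divDiff (i j : Fin N) (f : MvPolynomial (Fin N) F) : MvPolynomial (Fin N) F :=
  divExact (X i - X j) (f - Kswap i j f)

lemma X_sub_X_dvd_sub_Kswap (i j : Fin N) (f : MvPolynomial (Fin N) F) :
    X i - X j ∣ f - Kswap i j f := by
  induction f using MvPolynomial.induction_on with
  | C a => simp [Kswap]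
  | add p q hp hq =>
    have h : p + q - Kswap i j (p + q) = (p - Kswap i j p) + (q - Kswap i j q) := by
      simp only [Kswap, map_add]; ring
    rw [h]
    exact dvd_add hp hq
  | mul_X p k hp =>
    have h : p * X k - Kswap i j (p * X k)
        = X k * (p - Kswap i j p) + (X k - X (Equiv.swap i j k)) * Kswap i j p := by
      simp only [Kswap, map_mul, rename_X]; ring
    rw [h]
    refine dvd_add (hp.mul_left _) (Dvd.dvd.mul_right ?_ _)
    rcases eq_or_ne k i with rfl | hki
    · simp
    rcases eq_or_ne k j with rfl | hkj
    · rw [Equiv.swap_apply_right, ← neg_sub, neg_dvd]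
    · simp [Equiv.swap_apply_of_ne_of_ne hki hkj]

lemma X_sub_X_mul_divDiff (i j : Fin N) (f : MvPolynomial (Fin N) F) :
    (X i - X j) * divDiff i j f = f - Kswap i j f := by
  have h : ∃ c, f - Kswap i j f = (X i - X j) * c := X_sub_X_dvd_sub_Kswap i j f
  unfold divDiff divExact
  rw [dif_pos h]
  exact h.choose_spec.symm

lemma X_sub_X_ne_zero {i j : Fin N} (hij : i ≠ j) :
    (X i - X j : MvPolynomial (Fin N) F) ≠ 0 :=
  sub_ne_zero.2 fun h => hij (X_injective h)

lemma eq_divDiff {i j : Fin N} (hij : i ≠ j) {f g : MvPolynomial (Fin N) F}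
    (h : (X i - X j) * g = f - Kswap i j f) : divDiff i j f = g :=
  mul_left_cancel₀ (X_sub_X_ne_zero hij) ((X_sub_X_mul_divDiff i j f).trans h.symm)

lemma Kswap_comm (i j : Fin N) (f : MvPolynomial (Fin N) F) : Kswap i j f = Kswap j i f := by
  rw [Kswap, Kswap, Equiv.swap_comm]

lemma rename_Kswap (σ : Equiv.Perm (Fin N)) (i j : Fin N) (f : MvPolynomial (Fin N) F) :
    rename σ (Kswap i j f) = Kswap (σ i) (σ j) (rename σ f) := by
  simp only [Kswap, rename_rename]
  rw [← Equiv.Perm.coe_mul, ← Equiv.Perm.coe_mul, Equiv.mul_swap_eq_swap_mul]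

lemma rename_divDiff (σ : Equiv.Perm (Fin N)) {i j : Fin N} (hij : i ≠ j)
    (f : MvPolynomial (Fin N) F) :
    rename σ (divDiff i j f) = divDiff (σ i) (σ j) (rename σ f) := by
  refine (eq_divDiff (σ.injective.ne hij) ?_).symm
  rw [← rename_Kswap, ← map_sub, ← X_sub_X_mul_divDiff, map_mul, map_sub, rename_X, rename_X]

lemma rename_pderiv (σ : Equiv.Perm (Fin N)) (i : Fin N) (f : MvPolynomial (Fin N) F) :
    rename σ (pderiv i f) = pderiv (σ i) (rename σ f) :=
  (pderiv_rename σ.injective i f).symm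

lemma nabla_eq (β : F) (i : Fin N) (f : MvPolynomial (Fin N) F) :
    nabla β i f = pderiv i f + β • ∑ j ∈ univ.erase i, divDiff i j f := rfl

/-- The Dunkl operator as a linear map. -/
noncomputable def nablaHom (β : F) (i : Fin N) :
    MvPolynomial (Fin N) F →ₗ[F] MvPolynomial (Fin N) F where
  toFun := nabla β i
  map_add' f g := by
    have h : ∑ j ∈ univ.erase i, divDiff i j (f + g)
        = ∑ j ∈ univ.erase i, divDiff i j f + ∑ j ∈ univ.erase i, divDiff i j g := by
      rw [← sum_add_distrib]
      refine sum_congr rfl fun j hj => eq_divDiff (ne_of_mem_erase hj).symm ?_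
      rw [mul_add, X_sub_X_mul_divDiff, X_sub_X_mul_divDiff]
      simp only [Kswap, map_add]; ring
    simp only [nabla_eq, h, map_add, smul_add]
    abel
  map_smul' c f := by
    have h : ∑ j ∈ univ.erase i, divDiff i j (c • f) = c • ∑ j ∈ univ.erase i, divDiff i j f := by
      rw [smul_sum]
      refine sum_congr rfl fun j hj => eq_divDiff (ne_of_mem_erase hj).symm ?_
      rw [mul_smul_comm, X_sub_X_mul_divDiff]
      simp only [Kswap, map_smul, smul_sub]
    simp only [nabla_eq, h, (pderiv i).map_smul, smul_add, RingHom.id_apply, smul_comm c β]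

lemma nabla_add (β : F) (i : Fin N) (f g : MvPolynomial (Fin N) F) :
    nabla β i (f + g) = nabla β i f + nabla β i g := (nablaHom β i).map_add f g

lemma nabla_sub (β : F) (i : Fin N) (f g : MvPolynomial (Fin N) F) :
    nabla β i (f - g) = nabla β i f - nabla β i g := (nablaHom β i).map_sub f g

lemma nabla_smul (β : F) (i : Fin N) (c : F) (f : MvPolynomial (Fin N) F) :
    nabla β i (c • f) = c • nabla β i f := (nablaHom β i).map_smul c f

lemma nabla_sum {ι : Type*} (β : F) (i : Fin N) (s : Finset ι) (f : ι → MvPolynomial (Fin N) F) :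
    nabla β i (∑ k ∈ s, f k) = ∑ k ∈ s, nabla β i (f k) := map_sum (nablaHom β i) f s

lemma nabla_C (β : F) (i : Fin N) (a : F) :
    nabla β i (C a : MvPolynomial (Fin N) F) = 0 := by
  rw [nabla_eq, pderiv_C, zero_add, sum_eq_zero, smul_zero]
  intro j hj
  exact eq_divDiff (ne_of_mem_erase hj).symm (by simp [Kswap])

lemma rename_nabla (β : F) (σ : Equiv.Perm (Fin N)) (i : Fin N) (f : MvPolynomial (Fin N) F) :
    rename σ (nabla β i f) = nabla β (σ i) (rename σ f) := by
  rw [nabla_eq, nabla_eq, map_add, map_smul, rename_pderiv, map_sum]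
  congr 2
  refine sum_equiv σ (by simp) fun j hj => rename_divDiff σ (ne_of_mem_erase hj).symm f

lemma Kswap_nabla_of_ne (β : F) {i j k : Fin N} (hj : i ≠ j) (hk : i ≠ k)
    (f : MvPolynomial (Fin N) F) :
    Kswap j k (nabla β i f) = nabla β i (Kswap j k f) := by
  rw [Kswap, rename_nabla, Equiv.swap_apply_of_ne_of_ne hj hk, Kswap]

lemma Kswap_nabla_left (β : F) (i j : Fin N) (f : MvPolynomial (Fin N) F) :
    Kswap i j (nabla β i f) = nabla β j (Kswap i j f) := by
  rw [Kswap, rename_nabla, Equiv.swap_apply_left, Kswap]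

lemma Kswap_nabla_right (β : F) (i j : Fin N) (f : MvPolynomial (Fin N) F) :
    Kswap i j (nabla β j f) = nabla β i (Kswap i j f) := by
  rw [Kswap, rename_nabla, Equiv.swap_apply_right, Kswap]

lemma divDiff_X_mul_self {i j : Fin N} (hij : i ≠ j) (f : MvPolynomial (Fin N) F) :
    divDiff i j (X i * f) = X i * divDiff i j f + Kswap i j f := by
  refine eq_divDiff hij ?_
  rw [mul_add, mul_left_comm, X_sub_X_mul_divDiff]
  simp only [Kswap, map_mul, rename_X, Equiv.swap_apply_left]; ring

lemma divDiff_X_mul_right {i j : Fin N} (hij : i ≠ j) (f : MvPolynomial (Fin N) F) :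
    divDiff i j (X j * f) = X j * divDiff i j f - Kswap i j f := by
  refine eq_divDiff hij ?_
  rw [mul_sub, mul_left_comm, X_sub_X_mul_divDiff]
  simp only [Kswap, map_mul, rename_X, Equiv.swap_apply_right]; ring

lemma divDiff_X_mul_of_ne {i j k : Fin N} (hij : i ≠ j) (hi : k ≠ i) (hj : k ≠ j)
    (f : MvPolynomial (Fin N) F) :
    divDiff i j (X k * f) = X k * divDiff i j f := by
  refine eq_divDiff hij ?_
  rw [mul_left_comm, X_sub_X_mul_divDiff]
  simp only [Kswap, map_mul, rename_X, Equiv.swap_apply_of_ne_of_ne hi hj]; ring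

lemma nabla_X_mul_self (β : F) (i : Fin N) (f : MvPolynomial (Fin N) F) :
    nabla β i (X i * f) = X i * nabla β i f + f + β • ∑ k ∈ univ.erase i, Kswap i k f := by
  have h : ∑ j ∈ univ.erase i, divDiff i j (X i * f)
      = X i * ∑ j ∈ univ.erase i, divDiff i j f + ∑ k ∈ univ.erase i, Kswap i k f := by
    rw [mul_sum, ← sum_add_distrib]
    exact sum_congr rfl fun j hj => divDiff_X_mul_self (ne_of_mem_erase hj).symm f
  rw [nabla_eq, nabla_eq, h, pderiv_mul, pderiv_X_self, smul_add, mul_add, mul_smul_comm]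
  ring

lemma nabla_X_mul_of_ne (β : F) {i k : Fin N} (hik : i ≠ k) (f : MvPolynomial (Fin N) F) :
    nabla β i (X k * f) = X k * nabla β i f - β • Kswap i k f := by
  have hk : k ∈ univ.erase i := mem_erase.2 ⟨hik.symm, mem_univ _⟩
  have h : ∑ j ∈ univ.erase i, divDiff i j (X k * f)
      = X k * ∑ j ∈ univ.erase i, divDiff i j f - Kswap i k f := by
    rw [← add_sum_erase _ _ hk, ← add_sum_erase _ (fun j => divDiff i j f) hk,
      divDiff_X_mul_right hik, mul_add, mul_sum]
    have h' : ∑ j ∈ (univ.erase i).erase k, divDiff i j (X k * f)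
        = ∑ j ∈ (univ.erase i).erase k, X k * divDiff i j f :=
      sum_congr rfl fun j hj => divDiff_X_mul_of_ne
        (ne_of_mem_erase (mem_of_mem_erase hj)).symm hik.symm (ne_of_mem_erase hj).symm f
    rw [h']
    ring
  rw [nabla_eq, nabla_eq, h, pderiv_mul, pderiv_X_of_ne hik.symm, smul_sub, mul_add,
    mul_smul_comm]
  ring

lemma nabla_comm_X_mul_right (β : F) {i j : Fin N} (hij : i ≠ j) {f : MvPolynomial (Fin N) F}
    (hf : nabla β i (nabla β j f) = nabla β j (nabla β i f)) :
    nabla β i (nabla β j (X j * f)) = nabla β j (nabla β i (X j * f)) := by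
  have hi : i ∈ univ.erase j := mem_erase.2 ⟨hij, mem_univ _⟩
  have h : ∑ m ∈ (univ.erase j).erase i, nabla β i (Kswap j m f)
      = ∑ m ∈ (univ.erase j).erase i, Kswap j m (nabla β i f) :=
    sum_congr rfl fun m hm => (Kswap_nabla_of_ne β hij (ne_of_mem_erase hm).symm f).symm
  rw [nabla_X_mul_self, nabla_X_mul_of_ne β hij, nabla_add, nabla_add, nabla_sub,
    nabla_smul, nabla_smul, nabla_sum, nabla_X_mul_of_ne β hij, nabla_X_mul_self,
    ← add_sum_erase _ _ hi, ← add_sum_erase _ (fun m => Kswap j m (nabla β i f)) hi, h, hf,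
    Kswap_nabla_right, Kswap_nabla_right, Kswap_comm j i, smul_add, smul_add]
  ring

/-- The Dunkl operators commute. -/
lemma nabla_comm (β : F) (i j : Fin N) (f : MvPolynomial (Fin N) F) :
    nabla β i (nabla β j f) = nabla β j (nabla β i f) := by
  rcases eq_or_ne i j with rfl | hij
  · rfl
  induction f using MvPolynomial.induction_on with
  | C a => simp [nabla_C, show nabla β i (0 : MvPolynomial (Fin N) F) = 0 from
      (nablaHom β i).map_zero, show nabla β j (0 : MvPolynomial (Fin N) F) = 0 from
      (nablaHom β j).map_zero]
  | add p q hp hq => simp only [nabla_add, hp, hq]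
  | mul_X p k hp =>
    rw [mul_comm]
    rcases eq_or_ne k j with rfl | hkj
    · exact nabla_comm_X_mul_right β hij hp
    rcases eq_or_ne k i with rfl | hki
    · exact (nabla_comm_X_mul_right β hij.symm hp.symm).symm
    · rw [nabla_X_mul_of_ne β hkj.symm, nabla_X_mul_of_ne β hki.symm, nabla_sub, nabla_sub,
        nabla_smul, nabla_smul, nabla_X_mul_of_ne β hki.symm, nabla_X_mul_of_ne β hkj.symm, hp,
        Kswap_nabla_of_ne β hij.symm hkj.symm, Kswap_nabla_of_ne β hij hki.symm]
      ring

lemma Dop_add (β : F) (i : Fin N) (f g : MvPolynomial (Fin N) F) :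
    Dop β i (f + g) = Dop β i f + Dop β i g := by
  rw [Dop, nabla_add, mul_add, Dop, Dop]

lemma Dop_smul (β : F) (i : Fin N) (c : F) (f : MvPolynomial (Fin N) F) :
    Dop β i (c • f) = c • Dop β i f := by
  rw [Dop, nabla_smul, mul_smul_comm, Dop]

lemma rename_Dop (β : F) (σ : Equiv.Perm (Fin N)) (i : Fin N) (f : MvPolynomial (Fin N) F) :
    rename σ (Dop β i f) = Dop β (σ i) (rename σ f) := by
  rw [Dop, map_mul, rename_X, rename_nabla, Dop]

lemma Dop_Dop_of_Kswap (β : F) {i j : Fin N} (hij : i ≠ j) {f : MvPolynomial (Fin N) F}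
    (hf : Kswap i j f = f) :
    Dop β i (Dop β j f) + β • Dop β i f = X i * X j * nabla β i (nabla β j f) := by
  rw [Dop, Dop, Dop, nabla_X_mul_of_ne β hij, Kswap_nabla_right, hf, mul_sub, mul_smul_comm]
  ring

lemma Dop_comm_of_Kswap (β : F) {i j : Fin N} (hij : i ≠ j) {f : MvPolynomial (Fin N) F}
    (hf : Kswap i j f = f) :
    Dop β i (Dop β j f) + β • Dop β i f = Dop β j (Dop β i f) + β • Dop β j f := by
  rw [Dop_Dop_of_Kswap β hij hf, Dop_Dop_of_Kswap β hij.symm (by rw [Kswap_comm, hf]),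
    nabla_comm, mul_comm (X i)]

lemma rename_Dlist (β : F) (σ : Equiv.Perm (Fin N)) (k : ℕ) (L : List (Fin N))
    (f : MvPolynomial (Fin N) F) :
    rename σ (Dlist β k L f) = Dlist β k (L.map σ) (rename σ f) := by
  induction L generalizing k with
  | nil => rfl
  | cons j L ih => simp only [Dlist, List.map_cons, map_add, map_smul, rename_Dop, ih]

lemma Kswap_Dlist_of_notMem (β : F) {i j : Fin N} (k : ℕ) {L : List (Fin N)}
    {f : MvPolynomial (Fin N) F} (hi : i ∉ L) (hj : j ∉ L) (hf : Kswap i j f = f) :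
    Kswap i j (Dlist β k L f) = Dlist β k L f := by
  have h : L.map (Equiv.swap i j) = L := by
    conv_rhs => rw [← List.map_id L]
    refine List.map_congr_left fun a ha => Equiv.swap_apply_of_ne_of_ne ?_ ?_
    · rintro rfl; exact hi ha
    · rintro rfl; exact hj ha
  rw [Kswap, rename_Dlist, h, ← Kswap, hf]

lemma Dlist_perm (β : F) {f : MvPolynomial (Fin N) F} (hf : ∀ i j, Kswap i j f = f)
    {L L' : List (Fin N)} (h : L.Perm L') (hL : L.Nodup) (k : ℕ) :
    Dlist β k L f = Dlist β k L' f := by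
  induction h generalizing k with
  | nil => rfl
  | cons a _ ih => simp only [Dlist, ih (List.nodup_cons.1 hL).2]
  | swap a b L =>
    simp only [List.nodup_cons, List.mem_cons, not_or] at hL
    have hc := Dop_comm_of_Kswap β hL.1.1
      (Kswap_Dlist_of_notMem β (k + 1 + 1) hL.1.2 hL.2.1 (hf b a))
    simp only [Dlist, Dop_add, Dop_smul, smul_add, smul_smul, Nat.cast_add, Nat.cast_one,
      add_mul, one_mul, add_smul]
    linear_combination (exp := 1) hc
  | trans h₁ _ ih₁ ih₂ => exact (ih₁ hL k).trans (ih₂ (h₁.nodup_iff.1 hL) k)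

lemma DJ_eq_Dlist (β : F) {f : MvPolynomial (Fin N) F} (hf : ∀ i j, Kswap i j f = f)
    (k : ℕ) {J : Finset (Fin N)} {L : List (Fin N)} (hL : L.Nodup) (hJ : L.toFinset = J) :
    DJ β k J f = Dlist β k L f := by
  refine Dlist_perm β hf (List.perm_of_nodup_nodup_toFinset_eq (sort_nodup ..) hL ?_)
    (sort_nodup ..) k
  rw [hJ, sort_toFinset]

lemma rename_Bplus (β : F) (l : ℕ) {f : MvPolynomial (Fin N) F}
    (hf : ∀ σ : Equiv.Perm (Fin N), rename σ f = f) (σ : Equiv.Perm (Fin N)) :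
    rename σ (Bplus β l univ f) = Bplus β l univ f := by
  rw [Bplus, map_sum]
  refine sum_equiv σ.finsetCongr (by simp [mem_powersetCard]) fun J _ => ?_
  rw [map_mul, zJ, zJ, map_prod, Equiv.finsetCongr_apply, prod_map]
  congr 1
  · simp
  · rw [DJ, rename_Dlist, hf]
    symm
    refine DJ_eq_Dlist β (fun i j => hf _) 1 ((sort_nodup ..).map σ.injective) ?_
    ext a
    simp [mem_map_equiv, ← Equiv.eq_symm_apply]

end Dunkl

section Support

variable {F : Type*} [Field F] {N : ℕ}

/-- The exponent vectors in the convex hull of the permutations of `lam`, described by their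
supporting half-spaces. -/
def permHull (lam : Fin N → ℕ) : Set (Fin N →₀ ℕ) :=
  {v | ∀ w : Fin N → ℤ, ∃ σ : Equiv.Perm (Fin N), ∑ i, w i * v i ≤ ∑ i, w i * lam (σ i)}

lemma sum_mul_add_single (w : Fin N → ℤ) (u : Fin N →₀ ℕ) (i : Fin N) :
    ∑ k, w k * ((u + Finsupp.single i 1 : Fin N →₀ ℕ) k : ℤ) = ∑ k, w k * (u k : ℤ) + w i := by
  simp [mul_add, sum_add_distrib, Finsupp.single_apply]

lemma sum_mul_le_of_mem_permHull {lam : Fin N → ℕ} (hlam : Antitone lam) {v : Fin N →₀ ℕ}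
    (hv : v ∈ permHull lam) {w : Fin N → ℤ} (hw : Antitone w) :
    ∑ i, w i * v i ≤ ∑ i, w i * lam i := by
  obtain ⟨σ, hσ⟩ := hv w
  refine hσ.trans (Monovary.sum_mul_comp_perm_le_sum_mul (g := fun i => (lam i : ℤ)) ?_)
  exact hw.monovary fun a b hab => Int.ofNat_le.2 (hlam hab)

lemma sum_filter_le_of_mem_permHull {lam : Fin N → ℕ} (hlam : Antitone lam) {v : Fin N →₀ ℕ}
    (hv : v ∈ permHull lam) (k : ℕ) :
    ∑ i ∈ univ.filter (fun i : Fin N => (i : ℕ) < k), v i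
      ≤ ∑ i ∈ univ.filter (fun i : Fin N => (i : ℕ) < k), lam i := by
  have h := sum_mul_le_of_mem_permHull hlam hv (w := fun i => if (i : ℕ) < k then 1 else 0) <| by
    intro a b hab
    have : (a : ℕ) ≤ b := hab
    dsimp only
    split_ifs <;> omega
  simp only [ite_mul, one_mul, zero_mul, ← sum_filter] at h
  exact_mod_cast h

lemma sum_eq_of_mem_permHull {lam : Fin N → ℕ} {v : Fin N →₀ ℕ} (hv : v ∈ permHull lam) :
    ∑ i, v i = ∑ i, lam i := by
  obtain ⟨σ, hσ⟩ := hv fun _ => 1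
  obtain ⟨τ, hτ⟩ := hv fun _ => -1
  rw [← mul_sum, ← mul_sum, Equiv.sum_comp τ fun i => (lam i : ℤ)] at hτ
  rw [← mul_sum, ← mul_sum, Equiv.sum_comp σ fun i => (lam i : ℤ)] at hσ
  zify
  linarith

lemma mem_restrictSupport_iff_coeff {s : Set (Fin N →₀ ℕ)} {f : MvPolynomial (Fin N) F} :
    f ∈ restrictSupport F s ↔ ∀ v, v ∉ s → coeff v f = 0 := by
  rw [mem_restrictSupport_iff, Set.subset_def]
  refine forall_congr' fun v => ?_
  rw [mem_coe, mem_support_iff]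
  tauto

lemma coeff_eq_zero_of_X_sub_X_mul {i j : Fin N} (hij : i ≠ j) {f g : MvPolynomial (Fin N) F}
    (h : (X i - X j) * f = g) {Q : Set (Fin N →₀ ℕ)}
    (hQ : ∀ u, u + Finsupp.single j 1 ∈ Q → u + Finsupp.single i 1 ∈ Q)
    (hg : ∀ v ∈ Q, coeff v g = 0) (u : Fin N →₀ ℕ) (hu : u + Finsupp.single i 1 ∈ Q) :
    coeff u f = 0 := by
  induction hn : u j generalizing u with
  | zero =>
    have h0 := hg _ hu
    rw [← h, sub_mul, coeff_sub, add_comm u, coeff_X_mul, coeff_X_mul', if_neg] at h0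
    · simpa using h0
    · simp [hij, hn]
  | succ n ih =>
    obtain ⟨u, rfl⟩ : ∃ u', u = u' + Finsupp.single j 1 :=
      ⟨u - Finsupp.single j 1, (Finsupp.sub_add_single_one_cancel (by omega)).symm⟩
    have h0 := hg _ hu
    rw [← h, sub_mul, coeff_sub, add_comm _ (Finsupp.single i 1), coeff_X_mul,
      add_comm u, add_left_comm, coeff_X_mul, sub_eq_zero, ← add_comm u] at h0
    rw [h0, add_comm]
    refine ih _ (hQ _ ?_) ?_
    · rwa [add_right_comm] at hu
    · simpa [hij] using hn

lemma coeff_X_mul_eq_zero {i k : Fin N} {f : MvPolynomial (Fin N) F} {Q : Set (Fin N →₀ ℕ)}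
    (hQ : ∀ u, u + Finsupp.single k 1 ∈ Q → u + Finsupp.single i 1 ∈ Q)
    (hf : ∀ u, u + Finsupp.single i 1 ∈ Q → coeff u f = 0) {v : Fin N →₀ ℕ} (hv : v ∈ Q) :
    coeff v (X k * f) = 0 := by
  rw [coeff_X_mul']
  split_ifs with hk
  · refine hf _ (hQ _ ?_)
    rwa [Finsupp.sub_add_single_one_cancel (Finsupp.mem_support_iff.1 hk)]
  · rfl

lemma rename_mem_restrictSupport_permHull {lam : Fin N → ℕ} {f : MvPolynomial (Fin N) F}
    (hf : f ∈ restrictSupport F (permHull lam)) (σ : Equiv.Perm (Fin N)) :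
    rename σ f ∈ restrictSupport F (permHull lam) := by
  rw [mem_restrictSupport_iff_coeff] at hf ⊢
  intro v hv
  by_contra hne
  obtain ⟨u, rfl, hu⟩ := coeff_rename_ne_zero _ _ _ hne
  refine hv fun w => ?_
  obtain ⟨τ, hτ⟩ := not_not.1 (mt (hf u) hu) (w ∘ σ)
  refine ⟨τ * σ⁻¹, le_trans (le_of_eq ?_) (hτ.trans (le_of_eq ?_))⟩
  · refine (sum_equiv σ (by simp) fun i _ => ?_).symm
    simp [Finsupp.mapDomain_equiv_apply]
  · exact sum_equiv σ (by simp) fun i _ => by simp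

lemma X_mul_divDiff_mem_restrictSupport {lam : Fin N → ℕ} {f : MvPolynomial (Fin N) F}
    (hf : f ∈ restrictSupport F (permHull lam)) {i j k : Fin N} (hij : i ≠ j)
    (hk : k = i ∨ k = j) :
    X k * divDiff i j f ∈ restrictSupport F (permHull lam) := by
  have hg : f - Kswap i j f ∈ restrictSupport F (permHull lam) :=
    Submodule.sub_mem _ hf (rename_mem_restrictSupport_permHull hf _)
  rw [mem_restrictSupport_iff_coeff] at hg ⊢
  intro v hv
  simp only [permHull, Set.mem_ofPred_eq, not_forall, not_exists, not_le] at hv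
  obtain ⟨w, hw⟩ := hv
  let Q : Set (Fin N →₀ ℕ) :=
    {v | ∀ σ : Equiv.Perm (Fin N), ∑ i, w i * (lam (σ i) : ℤ) < ∑ i, w i * (v i : ℤ)}
  have hQ : ∀ v ∈ Q, v ∉ permHull lam := fun v hv hv' => by
    obtain ⟨σ, hσ⟩ := hv' w
    exact absurd (hv σ) hσ.not_gt
  have hstep : ∀ a b : Fin N, w b ≤ w a → ∀ u,
      u + Finsupp.single b 1 ∈ Q → u + Finsupp.single a 1 ∈ Q := fun a b hab u hu σ => by
    have := hu σ
    rw [sum_mul_add_single] at this ⊢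
    linarith
  rcases le_total (w j) (w i) with h | h
  · refine coeff_X_mul_eq_zero (i := i) (Q := Q) (hstep i k ?_) (fun u hu => ?_) hw
    · rcases hk with rfl | rfl
      exacts [le_rfl, h]
    · exact coeff_eq_zero_of_X_sub_X_mul hij (X_sub_X_mul_divDiff i j f) (hstep i j h)
        (fun v hv => hg v (hQ v hv)) u hu
  · refine coeff_X_mul_eq_zero (i := j) (Q := Q) (hstep j k ?_) (fun u hu => ?_) hw
    · rcases hk with rfl | rfl
      exacts [h, le_rfl]
    · refine coeff_eq_zero_of_X_sub_X_mul hij.symm (g := -(f - Kswap i j f)) ?_ (hstep j i h)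
        (fun v hv => ?_) u hu
      · rw [← X_sub_X_mul_divDiff]; ring
      · rw [coeff_neg, hg v (hQ v hv), neg_zero]

lemma coeff_X_mul_pderiv (i : Fin N) (f : MvPolynomial (Fin N) F) (v : Fin N →₀ ℕ) :
    coeff v (X i * pderiv i f) = v i * coeff v f := by
  rw [coeff_X_mul']
  split_ifs with h
  · have hv := Finsupp.mem_support_iff.1 h
    rw [coeff_pderiv, Finsupp.sub_add_single_one_cancel hv]
    obtain ⟨n, hn⟩ := Nat.exists_eq_succ_of_ne_zero hv
    simp [hn, mul_comm]
  · simp [Finsupp.notMem_support_iff.1 h]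

lemma Dop_eq (β : F) (i : Fin N) (f : MvPolynomial (Fin N) F) :
    Dop β i f = X i * pderiv i f + β • ∑ j ∈ univ.erase i, X i * divDiff i j f := by
  rw [Dop, nabla_eq, mul_add, mul_smul_comm, mul_sum]

lemma Dop_mem_restrictSupport (β : F) {lam : Fin N → ℕ} {f : MvPolynomial (Fin N) F}
    (hf : f ∈ restrictSupport F (permHull lam)) (i : Fin N) :
    Dop β i f ∈ restrictSupport F (permHull lam) := by
  rw [Dop_eq]
  refine Submodule.add_mem _ ?_ (Submodule.smul_mem _ _ (Submodule.sum_mem _ fun j hj =>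
    X_mul_divDiff_mem_restrictSupport hf (ne_of_mem_erase hj).symm (Or.inl rfl)))
  rw [mem_restrictSupport_iff_coeff] at hf ⊢
  intro v hv
  rw [coeff_X_mul_pderiv, hf v hv, mul_zero]

lemma Dlist_mem_restrictSupport (β : F) {lam : Fin N → ℕ} {f : MvPolynomial (Fin N) F}
    (hf : f ∈ restrictSupport F (permHull lam)) (k : ℕ) (L : List (Fin N)) :
    Dlist β k L f ∈ restrictSupport F (permHull lam) := by
  induction L generalizing k with
  | nil => exact hf
  | cons j L ih =>
    exact Submodule.add_mem _ (Dop_mem_restrictSupport β (ih _) j) (Submodule.smul_mem _ _ (ih _))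

/-- The leading coefficient of `D_i f` when `f` is symmetric in the variables from `i` on. -/
lemma coeff_Dop_of_antitone (β : F) {lam : Fin N →₀ ℕ} (hlam : Antitone lam)
    {f : MvPolynomial (Fin N) F} (hf : f ∈ restrictSupport F (permHull lam)) (i : Fin N)
    (hs : ∀ j, i < j → Kswap i j f = f) :
    coeff lam (Dop β i f) = lam i * coeff lam f := by
  rw [Dop_eq, coeff_add, coeff_X_mul_pderiv, coeff_smul, coeff_sum, sum_eq_zero, smul_zero,
    add_zero]
  intro j hj
  have hij := (ne_of_mem_erase hj).symm
  rcases lt_or_gt_of_ne hij with h | h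
  · rw [show divDiff i j f = 0 from eq_divDiff hij (by rw [hs j h, sub_self, mul_zero]),
      mul_zero, coeff_zero]
  have hmem := X_mul_divDiff_mem_restrictSupport hf hij (Or.inr rfl)
  rw [mem_restrictSupport_iff_coeff] at hmem
  rw [coeff_X_mul']
  split_ifs with hi
  swap
  · rfl
  have hi := Finsupp.sub_add_single_one_cancel (Finsupp.mem_support_iff.1 hi)
  rw [← coeff_X_mul _ j, add_comm]
  refine hmem _ fun hv => ?_
  let w : Fin N → ℤ := fun k => -(k : ℤ)
  have hle := sum_mul_le_of_mem_permHull (w := w) hlam hv fun a b hab =>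
    neg_le_neg (Int.ofNat_le.2 hab)
  have h1 := sum_mul_add_single w (lam - Finsupp.single i 1) i
  rw [sum_mul_add_single] at hle
  rw [hi] at h1
  have h2 : ((j : ℕ) : ℤ) < (i : ℕ) := Int.ofNat_lt.2 h
  simp only [w] at hle h1
  linarith

end Support

section MonomialSymmetric

variable {F : Type*} [Field F] {N : ℕ}

open Classical in
lemma coeff_msym (mu : Fin N → ℕ) (v : Fin N →₀ ℕ) :
    coeff v (msym N mu : MvPolynomial (Fin N) F)
      = if ∃ σ : Equiv.Perm (Fin N), ⇑v = fun i => mu (σ i) then 1 else 0 := by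
  have hX : ∀ u : Fin N → ℕ, (∏ i, X i ^ u i : MvPolynomial (Fin N) F)
      = monomial (Finsupp.equivFunOnFinite.symm u) 1 := fun u => by
    rw [monomial_eq, Finsupp.prod_fintype _ _ (by simp)]
    simp
  simp only [msym, coeff_sum, hX, coeff_monomial, Equiv.symm_apply_eq]
  rw [sum_ite_eq' _ _ fun _ => (1 : F)]
  refine if_congr ?_ rfl rfl
  simp only [mem_image, mem_univ, true_and]
  exact exists_congr fun σ => eq_comm

lemma rename_eq_self_iff {f : MvPolynomial (Fin N) F} :
    (∀ σ : Equiv.Perm (Fin N), rename σ f = f) ↔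
      ∀ (u v : Fin N →₀ ℕ) (σ : Equiv.Perm (Fin N)), (∀ i, v i = u (σ i)) →
        coeff v f = coeff u f := by
  constructor
  · intro hf u v σ h
    have huv : u = v.mapDomain σ := by
      ext i; simp [Finsupp.mapDomain_equiv_apply, h]
    conv_rhs => rw [huv, ← hf σ, coeff_rename_mapDomain _ σ.injective]
  · intro hf σ
    ext v
    have hv : v = (v.mapDomain σ.symm).mapDomain σ := by
      ext i; simp [Finsupp.mapDomain_equiv_apply]
    conv_lhs => rw [hv, coeff_rename_mapDomain _ σ.injective]
    exact hf _ _ σ fun i => by simp [Finsupp.mapDomain_equiv_apply]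

lemma rename_msym (mu : Fin N → ℕ) (σ : Equiv.Perm (Fin N)) :
    rename σ (msym N mu : MvPolynomial (Fin N) F) = msym N mu := by
  classical
  refine rename_eq_self_iff.2 (fun u v σ h => ?_) σ
  rw [coeff_msym, coeff_msym]
  refine if_congr ⟨?_, ?_⟩ rfl rfl
  · rintro ⟨τ, hτ⟩
    refine ⟨τ * σ⁻¹, funext fun i => ?_⟩
    have := congrFun hτ (σ⁻¹ i)
    rw [h] at this
    simpa using this
  · rintro ⟨τ, hτ⟩
    exact ⟨τ * σ, funext fun i => by rw [h, hτ]; rfl⟩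

lemma coeff_msym_self (mu : Fin N →₀ ℕ) :
    coeff mu (msym N mu : MvPolynomial (Fin N) F) = 1 := by
  rw [coeff_msym, if_pos ⟨1, rfl⟩]

lemma msym_mem_restrictSupport (lam : Fin N → ℕ) :
    (msym N lam : MvPolynomial (Fin N) F) ∈ restrictSupport F (permHull lam) := by
  rw [mem_restrictSupport_iff_coeff]
  intro v hv
  rw [coeff_msym, if_neg]
  rintro ⟨σ, hσ⟩
  exact hv fun w => ⟨σ, by rw [hσ]⟩

lemma exists_perm_antitone (v : Fin N → ℕ) :
    ∃ σ : Equiv.Perm (Fin N), Antitone fun i => v (σ i) :=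
  ⟨Tuple.sort (OrderDual.toDual ∘ v), fun _ _ hab =>
    Tuple.monotone_sort (OrderDual.toDual ∘ v) hab⟩

/-- A symmetric polynomial is a combination of the monomial symmetric polynomials attached to the
decreasing exponents in its support. -/
lemma mem_span_msym_of_symmetric (f : MvPolynomial (Fin N) F)
    (hf : ∀ σ : Equiv.Perm (Fin N), rename σ f = f) :
    f ∈ Submodule.span F {p : MvPolynomial (Fin N) F |
      ∃ mu ∈ f.support, Antitone mu ∧ p = msym N mu} := by
  induction hn : #f.support using Nat.strong_induction_on generalizing f with
  | _ n ih =>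
    rcases eq_or_ne f 0 with rfl | h0
    · exact Submodule.zero_mem _
    obtain ⟨v, hv⟩ := support_nonempty.2 h0
    obtain ⟨σ, hσ⟩ := exists_perm_antitone v
    let mu : Fin N →₀ ℕ := Finsupp.equivFunOnFinite.symm fun i => v (σ i)
    have hsymm := rename_eq_self_iff.1 hf
    have hmu : mu ∈ f.support := by
      rw [mem_support_iff] at hv ⊢
      rwa [hsymm v mu σ fun _ => rfl]
    set g := f - coeff mu f • msym N mu with hg
    have hsub : g.support ⊆ f.support.erase mu := by
      classical
      intro u hu
      rw [mem_support_iff, hg, coeff_sub, coeff_smul, coeff_msym] at hu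
      rw [mem_erase, mem_support_iff]
      by_cases hex : ∃ τ : Equiv.Perm (Fin N), ⇑u = fun i => mu (τ i)
      · obtain ⟨τ, hτ⟩ := hex
        rw [if_pos ⟨τ, hτ⟩, hsymm mu u τ (congrFun hτ)] at hu
        simp at hu
      · rw [if_neg hex, smul_zero, sub_zero] at hu
        exact ⟨fun h => hex ⟨1, by rw [h]; rfl⟩, hu⟩
    have hcard : #g.support < n := by
      rw [← hn]
      exact (card_le_card hsub).trans_lt (card_erase_lt_of_mem hmu)
    have hgs := ih _ hcard g (fun τ => by rw [hg, map_sub, map_smul, hf, rename_msym]) rfl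
    have hmumem : (msym N mu : MvPolynomial (Fin N) F) ∈ Submodule.span F
        {p | ∃ nu ∈ f.support, Antitone nu ∧ p = msym N nu} :=
      Submodule.subset_span ⟨mu, hmu, hσ, rfl⟩
    refine (Submodule.sub_mem_iff_left _ (Submodule.smul_mem _ (coeff mu f) hmumem)).1
      (Submodule.span_mono ?_ hgs)
    rintro p ⟨nu, hnu, h⟩
    exact ⟨nu, mem_of_mem_erase (hsub hnu), h⟩

end MonomialSymmetric

section LeadingTerm

variable {F : Type*} [Field F] {N : ℕ}

lemma coeff_Dlist_of_antitone (β : F) {lam : Fin N →₀ ℕ} (hlam : Antitone lam)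
    {f : MvPolynomial (Fin N) F} (hf : f ∈ restrictSupport F (permHull lam))
    (hs : ∀ i j, Kswap i j f = f) {e : ℕ → Fin N} (he : ∀ s < N, (e s : ℕ) = s)
    (t : ℕ) (ht : t ≤ N) (k : ℕ) :
    coeff lam (Dlist β k ((List.range t).map e).reverse f)
      = (∏ s ∈ range t, ((lam (e (t - 1 - s)) : F) + ((k + s : ℕ) : F) * β)) * coeff lam f := by
  induction t generalizing k with
  | zero => simp [Dlist]
  | succ t ih =>
    have hnot : ∀ j, e t ≤ j → j ∉ ((List.range t).map e).reverse := by
      intro j hj hmem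
      simp only [List.mem_reverse, List.mem_map, List.mem_range] at hmem
      obtain ⟨s, hst, rfl⟩ := hmem
      have : (e t : ℕ) ≤ e s := hj
      rw [he t (by omega), he s (by omega)] at this
      omega
    have hD := coeff_Dop_of_antitone β hlam
      (Dlist_mem_restrictSupport β hf (k + 1) ((List.range t).map e).reverse) (e t) fun j hj =>
        Kswap_Dlist_of_notMem β (k + 1) (hnot _ le_rfl) (hnot _ hj.le) (hs _ _)
    have hprod : ∏ s ∈ range t, ((lam (e (t + 1 - 1 - (s + 1))) : F) + ((k + (s + 1) : ℕ) : F) * β)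
        = ∏ s ∈ range t, ((lam (e (t - 1 - s)) : F) + ((k + 1 + s : ℕ) : F) * β) := by
      refine prod_congr rfl fun s _ => ?_
      rw [show t + 1 - 1 - (s + 1) = t - 1 - s by omega, show k + (s + 1) = k + 1 + s by omega]
    rw [List.range_succ, List.map_append, List.reverse_append, List.map_singleton,
      List.reverse_singleton, List.singleton_append, Dlist, coeff_add, coeff_smul, hD,
      ih (by omega), prod_range_succ', hprod, smul_eq_mul, Nat.add_sub_cancel, Nat.sub_zero]
    generalize (∏ s ∈ range t, _ : F) = c
    rw [add_zero k]
    ring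

lemma coeff_DJ_of_antitone (β : F) (l : ℕ) (hl : l ≤ N) {lam : ℕ → ℕ}
    {lamF : Fin N →₀ ℕ} (hlam : Antitone lamF) (hlamF : ∀ i, lamF i = lam i)
    {f : MvPolynomial (Fin N) F} (hf : f ∈ restrictSupport F (permHull lamF))
    (hs : ∀ i j, Kswap i j f = f) :
    coeff lamF (DJ β 1 (univ.filter fun i : Fin N => (i : ℕ) < l) f)
      = (∏ j ∈ Icc 1 l, ((lam (l - j) : F) + (j : F) * β)) * coeff lamF f := by
  rcases Nat.eq_zero_or_pos N with rfl | hN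
  · obtain rfl : l = 0 := by omega
    simp [DJ, Dlist]
  have : NeZero N := ⟨hN.ne'⟩
  have he : ∀ s < N, (Fin.ofNat N s : ℕ) = s := fun s hs => Nat.mod_eq_of_lt hs
  have hnodup : ((List.range l).map (Fin.ofNat N)).reverse.Nodup := by
    rw [List.nodup_reverse]
    refine List.Nodup.map_on (fun a ha b hb hab => ?_) List.nodup_range
    rw [List.mem_range] at ha hb
    rw [← he a (by omega), ← he b (by omega), hab]
  have hset : ((List.range l).map (Fin.ofNat N)).reverse.toFinset
      = univ.filter fun i : Fin N => (i : ℕ) < l := by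
    ext i
    simp only [List.mem_toFinset, List.mem_reverse, List.mem_map, List.mem_range, mem_filter,
      mem_univ, true_and]
    constructor
    · rintro ⟨s, hsl, rfl⟩
      rwa [he s (by omega)]
    · exact fun hi => ⟨i, hi, Fin.ext (he i i.isLt)⟩
  rw [DJ_eq_Dlist β hs 1 hnodup hset, coeff_Dlist_of_antitone β hlam hf hs he l hl 1,
    ← Ico_add_one_right_eq_Icc, prod_Ico_eq_prod_range, Nat.add_sub_cancel]
  congr 1
  refine prod_congr rfl fun s hsl => ?_
  rw [mem_range] at hsl
  rw [hlamF, he _ (by omega), Nat.sub_sub]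

lemma zJ_eq_monomial (J : Finset (Fin N)) :
    (zJ J : MvPolynomial (Fin N) F) = monomial (∑ i ∈ J, Finsupp.single i 1) 1 := by
  rw [zJ, monomial_sum_one]
  rfl

lemma sum_single_apply (J : Finset (Fin N)) (k : Fin N) :
    (∑ i ∈ J, Finsupp.single i 1 : Fin N →₀ ℕ) k = if k ∈ J then 1 else 0 := by
  simp [Finsupp.finsetSum_apply, Finsupp.single_apply]

lemma exists_of_coeff_zJ_mul_ne_zero {J : Finset (Fin N)} {f : MvPolynomial (Fin N) F}
    {lam : Fin N → ℕ} (hf : f ∈ restrictSupport F (permHull lam)) {u : Fin N →₀ ℕ}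
    (hu : coeff u (zJ J * f) ≠ 0) :
    ∃ v ∈ permHull lam, u = ∑ i ∈ J, Finsupp.single i 1 + v := by
  rw [zJ_eq_monomial, coeff_monomial_mul', one_mul] at hu
  split_ifs at hu with h
  · exact ⟨_, not_not.1 fun hv => hu (mem_restrictSupport_iff_coeff.1 hf _ hv),
      (add_tsub_cancel_of_le h).symm⟩
  · exact absurd rfl hu

lemma sum_filter_single_add (J S : Finset (Fin N)) (v : Fin N →₀ ℕ) :
    ∑ i ∈ S, (∑ i ∈ J, Finsupp.single i 1 + v : Fin N →₀ ℕ) i = #(S ∩ J) + ∑ i ∈ S, v i := by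
  simp_rw [Finsupp.add_apply, sum_add_distrib, sum_single_apply]
  rw [← sum_filter, sum_const, smul_eq_mul, mul_one, filter_mem_eq_inter]

end LeadingTerm

/-- for `ℓ ≤ N-1` and a partition `λ` with at most `ℓ` parts
(`lam` 0-indexed, `lam j = 0` for `j ≥ ℓ`),
`B⁺_ℓ m_λ = a_λ m_{λ+1} + ∑_{λ' < λ+1} d_{λ,λ'} m_{λ'}` with
`a_λ = ∏_{j=1}^{ℓ} (λ_{ℓ+1-j} + jβ)` and `λ+1 = (λ_1+1,…,λ_ℓ+1)`. -/
theorem statement_19 {F : Type*} [Field F] [CharZero F] {N : ℕ} (β : F) (l : ℕ)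
    (hl : l ≤ N - 1)
    (lam : ℕ → ℕ) (hmono : ∀ a b : ℕ, a ≤ b → lam b ≤ lam a)
    (hzero : ∀ j, l ≤ j → lam j = 0) :
    ∃ g ∈ Submodule.span F {p : MvPolynomial (Fin N) F |
      ∃ mu : Fin N → ℕ,
        (∀ a b : Fin N, a ≤ b → mu b ≤ mu a) ∧
        (∑ i, mu i = (∑ i : Fin N, lam (i : ℕ)) + l) ∧
        (∀ k : ℕ, ∑ i ∈ Finset.univ.filter (fun i : Fin N => (i : ℕ) < k), mu i ≤
          ∑ i ∈ Finset.univ.filter (fun i : Fin N => (i : ℕ) < k),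
            (if (i : ℕ) < l then lam (i : ℕ) + 1 else 0)) ∧
        mu ≠ (fun i : Fin N => if (i : ℕ) < l then lam (i : ℕ) + 1 else 0) ∧
        p = msym N mu},
      Bplus β l Finset.univ (msym N (fun i : Fin N => lam (i : ℕ)))
        = (∏ j ∈ Finset.Icc 1 l, ((lam (l - j) : F) + (j : F) * β))
            • msym N (fun i : Fin N => if (i : ℕ) < l then lam (i : ℕ) + 1 else 0) + g := by
  classical
  have hlN : l ≤ N := hl.trans (Nat.sub_le _ _)
  set lamN : Fin N → ℕ := fun i => lam i with hlamN
  set top : Fin N → ℕ := fun i => if (i : ℕ) < l then lam (i : ℕ) + 1 else 0 with htop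
  let lamF : Fin N →₀ ℕ := Finsupp.equivFunOnFinite.symm lamN
  let topF : Fin N →₀ ℕ := Finsupp.equivFunOnFinite.symm top
  set J₀ : Finset (Fin N) := univ.filter fun i : Fin N => (i : ℕ) < l with hJ₀
  have hJ₀card : #J₀ = l := by simp [hJ₀, Fin.card_filter_val_lt, hlN]
  have hanti : Antitone lamN := fun a b hab => hmono a b hab
  have htopF : topF = ∑ i ∈ J₀, Finsupp.single i 1 + lamF := by
    ext i
    rw [Finsupp.add_apply, sum_single_apply]
    by_cases hi : (i : ℕ) < l
    · simp [topF, top, lamF, lamN, hJ₀, hi, add_comm]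
    · simp [topF, top, lamF, lamN, hJ₀, hi, hzero i (not_lt.1 hi)]
  have hsum (k : ℕ) : ∑ i ∈ univ.filter (fun i : Fin N => (i : ℕ) < k), top i
      = #(univ.filter (fun i : Fin N => (i : ℕ) < k) ∩ J₀)
        + ∑ i ∈ univ.filter (fun i : Fin N => (i : ℕ) < k), lamN i := by
    refine Eq.trans ?_ (sum_filter_single_add J₀ _ lamF)
    rw [← htopF]
    rfl
  set m : MvPolynomial (Fin N) F := msym N lamN with hm
  have hmsymm : ∀ σ : Equiv.Perm (Fin N), rename σ m = m := rename_msym lamN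
  have hmem : m ∈ restrictSupport F (permHull lamN) := msym_mem_restrictSupport lamN
  have hDJ (J : Finset (Fin N)) : DJ β 1 J m ∈ restrictSupport F (permHull lamN) :=
    Dlist_mem_restrictSupport β hmem _ _
  set a : F := ∏ j ∈ Icc 1 l, ((lam (l - j) : F) + (j : F) * β) with ha
  have hlead : coeff topF (Bplus β l univ m) = a := by
    rw [Bplus, coeff_sum, sum_eq_single_of_mem J₀ (mem_powersetCard.2 ⟨subset_univ _, hJ₀card⟩)]
    · rw [htopF, zJ_eq_monomial, coeff_monomial_mul, one_mul,
        coeff_DJ_of_antitone β l hlN (lam := lam) (lamF := lamF) hanti (fun _ => rfl) hmem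
          (fun i j => hmsymm _)]
      rw [hm, show lamN = ⇑lamF from rfl, coeff_msym_self, mul_one]
    · intro J hJ hne
      by_contra hcoeff
      obtain ⟨v, hv, hvJ⟩ := exists_of_coeff_zJ_mul_ne_zero (hDJ J) hcoeff
      have h1 := sum_filter_le_of_mem_permHull hanti hv l
      have h2 := congrArg (fun u : Fin N →₀ ℕ => ∑ i ∈ J₀, u i) hvJ
      simp only [htopF, sum_filter_single_add, inter_self] at h2
      have h3 : #J₀ ≤ #(J₀ ∩ J) := by
        change #J₀ + ∑ i ∈ J₀, lamN i = _ at h2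
        rw [← hJ₀] at h1
        omega
      refine hne (eq_of_subset_of_card_le (fun i hi => ?_) ?_).symm
      · exact (mem_inter.1 (eq_of_subset_of_card_le inter_subset_left h3 ▸ hi)).2
      · rw [(mem_powersetCard.1 hJ).2, hJ₀card]
  set g : MvPolynomial (Fin N) F := Bplus β l univ m - a • msym N top with hg
  refine ⟨g, Submodule.span_mono ?_ (mem_span_msym_of_symmetric g fun σ => ?_),
    (add_sub_cancel _ _).symm⟩
  swap
  · rw [hg, map_sub, map_smul, rename_Bplus β l hmsymm, rename_msym]
  rintro p ⟨mu, hmu, hmuanti, rfl⟩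
  have htopne : coeff topF g = 0 := by
    rw [hg, coeff_sub, hlead, coeff_smul, show top = ⇑topF from rfl, coeff_msym_self]
    simp
  rw [mem_support_iff] at hmu
  have hne : ⇑mu ≠ top := fun h => hmu <| by
    rw [show mu = topF from DFunLike.coe_injective h, htopne]
  have htopanti : Antitone top := by
    intro i j hij
    have h1 : (i : ℕ) ≤ j := hij
    have h2 := hmono _ _ h1
    simp only [htop]
    split_ifs <;> omega
  have hcoeff : coeff mu (Bplus β l univ m) ≠ 0 := by
    intro h0
    rw [hg, coeff_sub, h0, coeff_smul, coeff_msym, if_neg, smul_zero, sub_zero] at hmu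
    · exact hmu rfl
    rintro ⟨σ, hσ⟩
    refine hne ?_
    have := Tuple.unique_antitone (f := top) (σ := σ) (τ := 1) (by rwa [hσ] at hmuanti) htopanti
    rw [hσ]
    exact this
  rw [Bplus, coeff_sum] at hcoeff
  obtain ⟨J, hJ, hJne⟩ := exists_ne_zero_of_sum_ne_zero hcoeff
  obtain ⟨v, hv, rfl⟩ := exists_of_coeff_zJ_mul_ne_zero (hDJ J) hJne
  have hJcard := (mem_powersetCard.1 hJ).2
  refine ⟨_, hmuanti, ?_, fun k => ?_, hne, rfl⟩
  · rw [sum_filter_single_add, univ_inter, hJcard, sum_eq_of_mem_permHull hv, add_comm]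
  · rw [hsum, sum_filter_single_add]
    refine add_le_add ?_ (sum_filter_le_of_mem_permHull hanti hv k)
    rcases le_total k l with hkl | hkl
    · rw [(inter_eq_left (t := J₀)).2 fun i hi => ?_]
      · exact card_le_card inter_subset_left
      · simp only [hJ₀, mem_filter, mem_univ, true_and] at hi ⊢
        omega
    · rw [(inter_eq_right (s := J₀)).2 fun i hi => ?_]
      · rw [hJ₀card, ← hJcard]
        exact card_le_card inter_subset_right
      · simp only [hJ₀, mem_filter, mem_univ, true_and] at hi ⊢
        omega
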